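/- Let ℓ = 3 and let A be plus-one generated with a minimal set of homogeneous generators θ_E, θ_1, θ_2, φ for D(A) such that deg θ_i = d_i, deg φ = d, with θ_1, θ_2, φ ∈ D_H(A) for some H ∈ A, and whose relation is f_1 θ_1 + f_2 θ_2 + α φ = 0 (f_1, f_2 ∈ S, α ∈ V*). Then f_1 ≠ 0, f_2 ≠ 0 and α ≠ 0. -/

import Mathlib

open MvPolynomial

noncomputable section

attribute [local instance] Classical.propDecidable

namespace ArrPOG

variable (K : Type) [Field K] (ℓ : ℕ)

/-- A polynomial vector field on `K^ℓ`: `θ = Σ θᵢ ∂/∂xᵢ`, identified with its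
coefficient vector `(θ₁,…,θ_ℓ)` in `S = K[x₁,…,x_ℓ]`. -/
abbrev Deriv : Type := Fin ℓ → MvPolynomial (Fin ℓ) K

variable {K ℓ}

/-- The linear polynomial `α_H ∈ S` associated to a linear form `φ ∈ V*`. -/
def linPoly (φ : Module.Dual K (Fin ℓ → K)) : MvPolynomial (Fin ℓ) K :=
  ∑ i, MvPolynomial.C (φ (Pi.single i 1)) * MvPolynomial.X i

/-- `θ(α)` for a derivation `θ` and the linear form `α` given by `φ ∈ V*`. -/
def applyLin (θ : Deriv K ℓ) (φ : Module.Dual K (Fin ℓ → K)) : MvPolynomial (Fin ℓ) K :=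
  ∑ i, MvPolynomial.C (φ (Pi.single i 1)) * θ i

/-- An arrangement: a finite set of hyperplanes (kernels of nonzero linear forms). -/
def IsArrangement (A : Finset (Submodule K (Fin ℓ → K))) : Prop :=
  ∀ H ∈ A, ∃ φ : Module.Dual K (Fin ℓ → K), φ ≠ 0 ∧ LinearMap.ker φ = H

/-- Essential: the common intersection of all members is `0`. -/
def Essential (A : Finset (Submodule K (Fin ℓ → K))) : Prop :=
  A.inf id = ⊥

/-- Membership in the logarithmic derivation module `D(A)`:
`θ(α_H) ∈ S·α_H` for every `H ∈ A`. -/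
def InD (A : Finset (Submodule K (Fin ℓ → K))) (θ : Deriv K ℓ) : Prop :=
  ∀ H ∈ A, ∀ φ : Module.Dual K (Fin ℓ → K), LinearMap.ker φ = H → linPoly φ ∣ applyLin θ φ

/-- A derivation is homogeneous of degree `n` if all its coefficients are. -/
def HomogDeriv (θ : Deriv K ℓ) (n : ℕ) : Prop := ∀ i, (θ i).IsHomogeneous n

/-- `θ₁,…,θₙ` generate `D(A)` as an `S`-module. -/
def GeneratesD {n : ℕ} (A : Finset (Submodule K (Fin ℓ → K))) (θ : Fin n → Deriv K ℓ) : Prop :=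
  (∀ i, InD A (θ i)) ∧
    ∀ η, InD A η → ∃ c : Fin n → MvPolynomial (Fin ℓ) K, η = ∑ i, c i • θ i

/-- `S`-linear independence of a family of derivations. -/
def IndepD {n : ℕ} (θ : Fin n → Deriv K ℓ) : Prop :=
  ∀ c : Fin n → MvPolynomial (Fin ℓ) K, (∑ i, c i • θ i) = 0 → ∀ i, c i = 0

/-- `A` is free with exponents `e`: `D(A)` has a homogeneous basis of degrees `e i`. -/
def IsFreeExp (A : Finset (Submodule K (Fin ℓ → K))) (e : Fin ℓ → ℕ) : Prop :=
  ∃ θ : Fin ℓ → Deriv K ℓ, (∀ i, HomogDeriv (θ i) (e i)) ∧ GeneratesD A θ ∧ IndepD θ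

/-- `A` is free. -/
def IsFree (A : Finset (Submodule K (Fin ℓ → K))) : Prop := ∃ e, IsFreeExp A e

/-- `A` is plus-one generated with exponents `e`, level `lev`, realized by the minimal
homogeneous generators `θ₁,…,θ_ℓ, φ` whose unique syzygy is `Σ fᵢ•θᵢ + α•φ = 0`:
this encodes the minimal free resolution
`0 → S[-lev-1] → S[-lev] ⊕ (⊕ S[-eᵢ]) → D(A) → 0`. -/
def IsPOGWith (A : Finset (Submodule K (Fin ℓ → K))) (e : Fin ℓ → ℕ) (lev : ℕ)
    (θ : Fin ℓ → Deriv K ℓ) (φ : Deriv K ℓ)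
    (f : Fin ℓ → MvPolynomial (Fin ℓ) K) (α : MvPolynomial (Fin ℓ) K) : Prop :=
  (∀ i, InD A (θ i)) ∧ InD A φ ∧
  (∀ i, HomogDeriv (θ i) (e i)) ∧ HomogDeriv φ lev ∧
  (∀ η, InD A η → ∃ (c : Fin ℓ → MvPolynomial (Fin ℓ) K) (g : MvPolynomial (Fin ℓ) K),
      η = (∑ i, c i • θ i) + g • φ) ∧
  α.IsHomogeneous 1 ∧
  (∀ i, (f i).IsHomogeneous (lev + 1 - e i)) ∧
  (∀ i, MvPolynomial.constantCoeff (f i) = 0) ∧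
  ((∑ i, f i • θ i) + α • φ = 0) ∧
  (¬ (α = 0 ∧ ∀ i, f i = 0)) ∧
  (∀ (g : Fin ℓ → MvPolynomial (Fin ℓ) K) (h : MvPolynomial (Fin ℓ) K),
      ((∑ i, g i • θ i) + h • φ = 0) →
      ∃ q : MvPolynomial (Fin ℓ) K, (∀ i, g i = q * f i) ∧ h = q * α)

/-- Plus-one generated with exponents `e` and level `lev`. -/
def IsPOG (A : Finset (Submodule K (Fin ℓ → K))) (e : Fin ℓ → ℕ) (lev : ℕ) : Prop :=
  ∃ θ φ f α, IsPOGWith A e lev θ φ f α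

/-- Strictly plus-one generated: the level coefficient `α` is nonzero. -/
def IsSPOG (A : Finset (Submodule K (Fin ℓ → K))) (e : Fin ℓ → ℕ) (lev : ℕ) : Prop :=
  ∃ θ φ f α, IsPOGWith A e lev θ φ f α ∧ α ≠ 0

/-- The restriction `A^H = {L ⊓ H | L ∈ A \ {H}}`. -/
def restrict (A : Finset (Submodule K (Fin ℓ → K))) (H : Submodule K (Fin ℓ → K)) :
    Finset (Submodule K (Fin ℓ → K)) :=
  (A.erase H).image (fun L => L ⊓ H)

/-- The localization `A_X = {L ∈ A | X ⊆ L}`. -/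
def localize (A : Finset (Submodule K (Fin ℓ → K))) (X : Submodule K (Fin ℓ → K)) :
    Finset (Submodule K (Fin ℓ → K)) :=
  A.filter (fun L => X ≤ L)

/-- The intersection lattice of `A`, inside the ambient space `T`. -/
def latticeOf (T : Submodule K (Fin ℓ → K)) (A : Finset (Submodule K (Fin ℓ → K))) :
    Finset (Submodule K (Fin ℓ → K)) :=
  A.powerset.image (fun B => T ⊓ B.inf id)

/-- The Möbius function of the poset `L` (intersection lattice with top `T`). -/
def mob (T : Submodule K (Fin ℓ → K)) (L : Finset (Submodule K (Fin ℓ → K)))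
    (X : Submodule K (Fin ℓ → K)) : ℤ :=
  if X = T then 1
  else - ∑ Y ∈ (L.filter fun Z => X < Z).attach, mob T L Y.1
termination_by (L.filter fun Z => X < Z).card
decreasing_by
  obtain ⟨Y, hY⟩ := Y
  simp only [Finset.mem_filter] at hY
  apply Finset.card_lt_card
  rw [Finset.ssubset_def]
  constructor
  · intro Z hZ
    simp only [Finset.mem_filter] at hZ ⊢
    exact ⟨hZ.1, lt_trans hY.2 hZ.2⟩
  · intro hsub
    have h2 := hsub (Finset.mem_filter.mpr ⟨hY.1, hY.2⟩)
    simp only [Finset.mem_filter] at h2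
    exact lt_irrefl Y h2.2

/-- The characteristic polynomial `χ(A;t) = Σ_{X ∈ L(A)} μ(X) t^{dim X}`
of an arrangement inside the ambient space `T`. -/
def charPoly (T : Submodule K (Fin ℓ → K)) (A : Finset (Submodule K (Fin ℓ → K))) :
    Polynomial ℤ :=
  ∑ X ∈ latticeOf T A,
    Polynomial.C (mob T (latticeOf T A) X) * Polynomial.X ^ (Module.finrank K X)

/-- The Betti number `b_i(A)`: `χ(A;t) = Σ (-1)^i b_i(A) t^{ℓ-i}`. -/
def bNum (A : Finset (Submodule K (Fin ℓ → K))) (i : ℕ) : ℤ :=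
  (-1) ^ i * (charPoly (⊤ : Submodule K (Fin ℓ → K)) A).coeff (ℓ - i)

/-- Evaluation of the Poincaré polynomial `π(A;t) = Σ μ(X) (-t)^{codim X}` at `t : ℚ`. -/
def poincareEval (A : Finset (Submodule K (Fin ℓ → K))) (t : ℚ) : ℚ :=
  ∑ X ∈ latticeOf ⊤ A,
    (mob (⊤ : Submodule K (Fin ℓ → K)) (latticeOf ⊤ A) X : ℚ) *
      (-t) ^ (ℓ - Module.finrank K X)

/-- The Euler derivation `θ_E = Σ xᵢ ∂/∂xᵢ`. -/
def eulerD : Deriv K ℓ := fun i => MvPolynomial.X i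

/-- `A` is locally free: `A_X` is free for every `X ∈ L(A)` other than `∩_{H∈A} H`. -/
def LocallyFree (A : Finset (Submodule K (Fin ℓ → K))) : Prop :=
  ∀ X ∈ latticeOf ⊤ A, X ≠ A.inf id → IsFree (localize A X)

/-- Transport a finite set of subspaces contained in `T` to `K^m` along a linear
isomorphism `T ≃ K^m`. -/
def transport {m : ℕ} (T : Submodule K (Fin ℓ → K)) (eqv : T ≃ₗ[K] (Fin m → K))
    (A : Finset (Submodule K (Fin ℓ → K))) : Finset (Submodule K (Fin m → K)) :=
  A.image fun L => (L.comap T.subtype).map eqv.toLinearMap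

/-- An arrangement inside the subspace `T` is free with exponents `e`, i.e. it is free
after identifying `T` with a coordinate space. -/
def RestrFreeExp {m : ℕ} (T : Submodule K (Fin ℓ → K))
    (A : Finset (Submodule K (Fin ℓ → K))) (e : Fin m → ℕ) : Prop :=
  ∃ eqv : T ≃ₗ[K] (Fin m → K), IsFreeExp (transport T eqv A) e

/-- The multiset of exponents. -/
def expMS {n : ℕ} (e : Fin n → ℕ) : Multiset ℕ := Finset.univ.val.map e

/-- `D(A)` has projective dimension at most 1: some finite generating set has a free
(possibly zero) syzygy module, i.e. there is a free resolution
`0 → S^m → S^n → D(A) → 0`. -/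
def PdimLEOne (A : Finset (Submodule K (Fin ℓ → K))) : Prop :=
  ∃ (n m : ℕ) (θ : Fin n → Deriv K ℓ) (r : Fin m → Fin n → MvPolynomial (Fin ℓ) K),
    GeneratesD A θ ∧
    (∀ j, (∑ i, r j i • θ i) = 0) ∧
    (∀ c : Fin n → MvPolynomial (Fin ℓ) K, (∑ i, c i • θ i) = 0 →
      ∃ q : Fin m → MvPolynomial (Fin ℓ) K, ∀ i, c i = ∑ j, q j * r j i) ∧
    (∀ q : Fin m → MvPolynomial (Fin ℓ) K, (∀ i, (∑ j, q j * r j i) = 0) → ∀ j, q j = 0)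

/-- `A` has a free filtration `∅ = A₀ ⊂ A₁ ⊂ ⋯ ⊂ A_n = A`, `|A_i| = i`, each `A_i` free. -/
def HasFreeFiltration (A : Finset (Submodule K (Fin ℓ → K))) : Prop :=
  ∃ c : ℕ → Finset (Submodule K (Fin ℓ → K)),
    c A.card = A ∧ (∀ i ≤ A.card, (c i).card = i ∧ IsFree (c i)) ∧
    ∀ i < A.card, c i ⊆ c (i + 1)

/-- The intersection lattices of `A` and `B` are isomorphic: there is a bijection of
hyperplanes preserving the rank of every subset (equivalently, a lattice isomorphism). -/
def LatticeEquiv (A B : Finset (Submodule K (Fin ℓ → K))) : Prop :=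
  ∃ σ : Submodule K (Fin ℓ → K) → Submodule K (Fin ℓ → K),
    Set.BijOn σ ↑A ↑B ∧
    ∀ T ⊆ A, Module.finrank K ((T.inf id : Submodule K (Fin ℓ → K))) =
      Module.finrank K (((T.image σ).inf id : Submodule K (Fin ℓ → K)))


theorem applyLin_smul {K : Type} [Field K] {ℓ : ℕ} (c : MvPolynomial (Fin ℓ) K) (t : Deriv K ℓ)
    (p : Module.Dual K (Fin ℓ → K)) : applyLin (c • t) p = c * applyLin t p := by
  simp only [applyLin, Finset.mul_sum, Pi.smul_apply, smul_eq_mul]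
  exact Finset.sum_congr rfl fun i _ => by ring

theorem applyLin_add {K : Type} [Field K] {ℓ : ℕ} (s t : Deriv K ℓ)
    (p : Module.Dual K (Fin ℓ → K)) : applyLin (s + t) p = applyLin s p + applyLin t p := by
  simp only [applyLin, ← Finset.sum_add_distrib, Pi.add_apply, mul_add]

theorem linPoly_ne_zero {K : Type} [Field K] {ℓ : ℕ} (p : Module.Dual K (Fin ℓ → K))
    (hp : p ≠ 0) : linPoly p ≠ 0 := by
  intro h
  apply hp
  apply LinearMap.pi_ext'
  intro i
  ext
  have := congrArg (MvPolynomial.coeff (Finsupp.single i 1)) h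
  simpa [linPoly, MvPolynomial.coeff_sum, MvPolynomial.coeff_C_mul, MvPolynomial.coeff_X,
    Finsupp.single_left_inj] using this

theorem key_two {K : Type} [Field K] {ℓ : ℕ}
    (A : Finset (Submodule K (Fin ℓ → K)))
    (p : Module.Dual K (Fin ℓ → K)) (hp : p ≠ 0)
    (u v w : Deriv K ℓ) (f g : MvPolynomial (Fin ℓ) K)
    (hu : InD A u) (hv : InD A v)
    (hup : applyLin u p = 0) (hvp : applyLin v p = 0) (hwp : applyLin w p = 0)
    (hgen : ∀ η, InD A η → ∃ c0 c1 c2 c3 : MvPolynomial (Fin ℓ) K,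
      η = c0 • eulerD + c1 • u + c2 • v + c3 • w)
    (hf : constantCoeff f = 0) (hg : constantCoeff g = 0)
    (hrel : f • u + g • v = 0) (hne : ¬ (f = 0 ∧ g = 0))
    (hsyz : ∀ c1 c2 c3 : MvPolynomial (Fin ℓ) K, c1 • u + c2 • v + c3 • w = 0 →
      ∃ q, c1 = q * f ∧ c2 = q * g ∧ c3 = 0) : False := by
  have one : ∀ q : MvPolynomial (Fin ℓ) K, ∀ x, constantCoeff x = 0 → 1 ≠ q * x := by
    intro q x hx h
    have := congrArg constantCoeff h
    simp [hx] at this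
  have hf0 : f ≠ 0 := by
    intro h
    have hg0 : g ≠ 0 := fun h' => hne ⟨h, h'⟩
    have hv0 : v = 0 := by
      rw [h, zero_smul, zero_add] at hrel
      exact (smul_eq_zero.mp hrel).resolve_left hg0
    obtain ⟨q, _, h2, _⟩ := hsyz 0 1 0 (by simp [hv0])
    exact one q g hg h2
  have hg0 : g ≠ 0 := by
    intro h
    have hu0 : u = 0 := by
      rw [h, zero_smul, add_zero] at hrel
      exact (smul_eq_zero.mp hrel).resolve_left hf0
    obtain ⟨q, h1, _, _⟩ := hsyz 1 0 0 (by simp [hu0])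
    exact one q f hf h1
  have hcop : IsRelPrime f g := by
    rintro d ⟨a, rfl⟩ ⟨b, rfl⟩
    have hd : d ≠ 0 := left_ne_zero_of_mul hf0
    have h0 : a • u + b • v = 0 := by
      rw [mul_smul, mul_smul, ← smul_add] at hrel
      exact (smul_eq_zero.mp hrel).resolve_left hd
    obtain ⟨q, h1, _, _⟩ := hsyz a b 0 (by simp [h0])
    have ha : a ≠ 0 := right_ne_zero_of_mul hf0
    refine IsUnit.of_mul_eq_one q ?_
    apply mul_right_cancel₀ ha
    linear_combination -h1
  have hi : ∀ i, f * u i + g * v i = 0 := fun i => by simpa using congrFun hrel i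
  have hdv : ∀ i, g ∣ u i := fun i =>
    hcop.symm.dvd_of_dvd_mul_left ⟨-v i, by linear_combination hi i⟩
  choose η hη using hdv
  have hu' : u = g • (η : Deriv K ℓ) := by ext1 i; simpa using hη i
  have hv' : v = (-f) • (η : Deriv K ℓ) := by
    ext1 i
    apply mul_left_cancel₀ hg0
    simp only [Pi.smul_apply, smul_eq_mul]
    linear_combination hi i - f * hη i
  have hηD : InD A η := by
    intro L hL r hr
    have h1 := hu L hL r hr
    have h2 := hv L hL r hr
    rw [hu', applyLin_smul] at h1
    rw [hv', applyLin_smul, neg_mul, dvd_neg] at h2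
    letI : GCDMonoid (MvPolynomial (Fin ℓ) K) := UniqueFactorizationMonoid.toGCDMonoid _
    have h3 := dvd_gcd h1 h2
    have h4 := h3.trans (gcd_mul_right' (applyLin η r) g f).dvd
    have h5 : IsUnit (gcd g f) := hcop.symm (gcd_dvd_left _ _) (gcd_dvd_right _ _)
    exact (h5.dvd_mul_left).mp h4
  obtain ⟨c0, c1, c2, c3, hc⟩ := hgen η hηD
  have hηp : applyLin η p = 0 := by
    rw [hu', applyLin_smul] at hup
    exact (mul_eq_zero.mp hup).resolve_left hg0
  have hc0 : c0 = 0 := by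
    have h := congrArg (fun t => applyLin t p) hc
    simp only [applyLin_add, applyLin_smul, hηp, hup, hvp, hwp, mul_zero, add_zero] at h
    exact (mul_eq_zero.mp h.symm).resolve_right (linPoly_ne_zero p hp)
  have hrel2 : (1 - c1 * g + c2 * f) • u + (0 : MvPolynomial (Fin ℓ) K) • v + (-(g * c3)) • w = 0 := by
    ext1 i
    have h1 := congrFun hc i
    have h2 := congrFun hv' i
    have h3 := hη i
    simp only [hc0, Pi.add_apply, Pi.smul_apply, smul_eq_mul, Pi.zero_apply] at h1 h2 ⊢
    linear_combination h3 + g * h1 + c2 * hi i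
  obtain ⟨q, h1, h2, _⟩ := hsyz _ _ _ hrel2
  have hq : q = 0 := (mul_eq_zero.mp h2.symm).resolve_right hg0
  rw [hq, zero_mul] at h1
  have := congrArg constantCoeff h1
  simp [hf, hg] at this

/-- Proposition `nonzero`: let `ℓ = 3` and let `A` be plus-one
generated with minimal homogeneous generators `θ_E, θ₁, θ₂, φ`, where
`θ₁, θ₂, φ ∈ D_H(A)` for some `H ∈ A` and the relation is `f₁θ₁ + f₂θ₂ + αφ = 0`
(no `θ_E` component). Then `f₁ ≠ 0`, `f₂ ≠ 0` and `α ≠ 0`. -/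
theorem relation_coeffs_nonzero_dim3 {K : Type} [Field K]
    (A : Finset (Submodule K (Fin 3 → K)))
    (hA : IsArrangement A) (hEss : Essential A)
    (H : Submodule K (Fin 3 → K)) (hH : H ∈ A)
    (φH : Module.Dual K (Fin 3 → K)) (hker : LinearMap.ker φH = H)
    (e : Fin 3 → ℕ) (lev : ℕ)
    (θ : Fin 3 → Deriv K 3) (φ : Deriv K 3)
    (f : Fin 3 → MvPolynomial (Fin 3) K) (α : MvPolynomial (Fin 3) K)
    (hpog : IsPOGWith A e lev θ φ f α)
    (hθ0 : θ 0 = eulerD) (hf0 : f 0 = 0)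
    (hDH : ∀ i : Fin 3, i ≠ 0 → applyLin (θ i) φH = 0)
    (hDHφ : applyLin φ φH = 0) :
    f 1 ≠ 0 ∧ f 2 ≠ 0 ∧ α ≠ 0 := by
  obtain ⟨hD, hDφ, -, -, hgen, hα, -, hfc, hrel, hne, hsyz⟩ := hpog
  have hp : φH ≠ 0 := by
    rintro rfl
    obtain ⟨ψ, hψ, hk⟩ := hA H hH
    apply hψ
    rw [← LinearMap.ker_eq_top, hk, ← hker, LinearMap.ker_zero]
  have hαc : constantCoeff α = 0 := by
    rw [constantCoeff_eq]
    exact hα.coeff_eq_zero (by simp)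
  simp only [Fin.sum_univ_three, hθ0, hf0, zero_smul, zero_add] at hgen hrel hsyz
  have hs : ∀ c1 c2 c3 : MvPolynomial (Fin 3) K, c1 • θ 1 + c2 • θ 2 + c3 • φ = 0 →
      ∃ q, c1 = q * f 1 ∧ c2 = q * f 2 ∧ c3 = q * α := by
    intro c1 c2 c3 h
    obtain ⟨q, hq, hq'⟩ := hsyz ![0, c1, c2] c3 (by simpa using h)
    exact ⟨q, by simpa using hq 1, by simpa using hq 2, hq'⟩
  have hg : ∀ η, InD A η → ∃ c0 c1 c2 c3 : MvPolynomial (Fin 3) K,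
      η = c0 • eulerD + c1 • θ 1 + c2 • θ 2 + c3 • φ := by
    intro η h
    obtain ⟨c, g, hc⟩ := hgen η h
    exact ⟨c 0, c 1, c 2, g, hc⟩
  have hne' : ¬ (f 1 = 0 ∧ f 2 = 0 ∧ α = 0) := by
    rintro ⟨h1, h2, h3⟩
    refine hne ⟨h3, fun i => ?_⟩
    fin_cases i
    · exact hf0
    · exact h1
    · exact h2
  have d1 := hDH 1 (by decide)
  have d2 := hDH 2 (by decide)
  refine ⟨fun h => ?_, fun h => ?_, fun h => ?_⟩
  · refine key_two A φH hp (θ 2) φ (θ 1) (f 2) α (hD 2) hDφ d2 hDHφ d1 ?_ (hfc 2) hαc ?_ ?_ ?_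
    · intro η hη
      obtain ⟨c0, c1, c2, c3, hc⟩ := hg η hη
      exact ⟨c0, c2, c3, c1, by rw [hc]; abel⟩
    · simpa [h] using hrel
    · exact fun h' => hne' ⟨h, h'⟩
    · intro c1 c2 c3 hc
      obtain ⟨q, a, b, c⟩ := hs c3 c1 c2 (by rw [← hc]; abel)
      exact ⟨q, b, c, by rw [a, h, mul_zero]⟩
  · refine key_two A φH hp (θ 1) φ (θ 2) (f 1) α (hD 1) hDφ d1 hDHφ d2 ?_ (hfc 1) hαc ?_ ?_ ?_
    · intro η hη
      obtain ⟨c0, c1, c2, c3, hc⟩ := hg η hη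
      exact ⟨c0, c1, c3, c2, by rw [hc]; abel⟩
    · simpa [h] using hrel
    · exact fun h' => hne' ⟨h'.1, h, h'.2⟩
    · intro c1 c2 c3 hc
      obtain ⟨q, a, b, c⟩ := hs c1 c3 c2 (by rw [← hc]; abel)
      exact ⟨q, a, c, by rw [b, h, mul_zero]⟩
  · refine key_two A φH hp (θ 1) (θ 2) φ (f 1) (f 2) (hD 1) (hD 2) d1 d2 hDHφ hg
      (hfc 1) (hfc 2) ?_ ?_ ?_
    · simpa [h] using hrel
    · exact fun h' => hne' ⟨h'.1, h'.2, h⟩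
    · intro c1 c2 c3 hc
      obtain ⟨q, a, b, c⟩ := hs c1 c2 c3 hc
      exact ⟨q, a, b, by rw [c, h, mul_zero]⟩


end ArrPOG
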